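/- arXiv:0906.2330 — 2 statements merged into one kernel-verified Lean document; each statement's English description precedes it below -/
import Mathlib

section
/- (Newton's identity for Yangian homogeneous symmetric functions.) For every m ≥ 1 and every u ∈ ℂ, one has Σ_{k=0}^{m−1} h_k(u) * p⁺_{m−k}(u+k) = m • h_m(u) in the algebra A. -/
/-- Matrices in the `k`-leg model over `A`: square matrices indexed by functions
`Fin k → Fin n`, a model of `End((ℂ^n)^⊗k) ⊗ A`. -/
abbrev LegMatrix (n k : ℕ) (A : Type*) := Matrix (Fin k → Fin n) (Fin k → Fin n) A

variable {n : ℕ} {A : Type*} [Ring A] [Algebra ℂ A]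

/-- `T_s(v)`: the generating matrix `T(v)` placed on leg `s` of the `k`-leg model. -/
def Tleg (T : ℂ → Matrix (Fin n) (Fin n) A) {k : ℕ} (s : Fin k) (v : ℂ) :
    LegMatrix n k A := fun f g =>
  if ∀ t : Fin k, t ≠ s → f t = g t then T v (f s) (g s) else 0

/-- The permutation matrix `P_σ` of a permutation `σ` of the legs:
its `(f,g)`-entry is `1` (via `algebraMap ℂ A`) if `f = g ∘ σ` and `0` otherwise. -/
def Pleg (n : ℕ) (A : Type*) [Ring A] [Algebra ℂ A] {k : ℕ} (σ : Equiv.Perm (Fin k)) :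
    LegMatrix n k A := fun f g => if f = g ∘ σ then algebraMap ℂ A 1 else 0

/-- The transposition of legs with 1-based labels `i`, `j` (identity if out of range;
all uses are in range). -/
def legSwap (k i j : ℕ) : Equiv.Perm (Fin k) :=
  if h : 1 ≤ i ∧ i ≤ k ∧ 1 ≤ j ∧ j ≤ k then
    Equiv.swap ⟨i - 1, by omega⟩ ⟨j - 1, by omega⟩ else 1

/-- The antisymmetrizer `A_k = (1/k!) • Σ_σ sgn(σ) • P_σ` in the `k`-leg model. -/
noncomputable def Aleg (n : ℕ) (A : Type*) [Ring A] [Algebra ℂ A] (k : ℕ) :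
    LegMatrix n k A :=
  ((k.factorial : ℂ))⁻¹ •
    ∑ σ : Equiv.Perm (Fin k), ((Equiv.Perm.sign σ : ℤ) : ℂ) • Pleg n A σ

/-- The symmetrizer `S_k = (1/k!) • Σ_σ P_σ` in the `k`-leg model. -/
noncomputable def Sleg (n : ℕ) (A : Type*) [Ring A] [Algebra ℂ A] (k : ℕ) :
    LegMatrix n k A :=
  ((k.factorial : ℂ))⁻¹ • ∑ σ : Equiv.Perm (Fin k), Pleg n A σ

/-- The ordered product `T_1(u) * T_2(u+d) * ⋯ * T_k(u+(k−1)d)` in the `k`-leg model. -/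
noncomputable def TT (T : ℂ → Matrix (Fin n) (Fin n) A) (k : ℕ) (u d : ℂ) :
    LegMatrix n k A :=
  ((List.finRange k).map (fun s => Tleg T s (u + d * ((s : ℕ) : ℂ)))).prod

/-- The RTT relation of the Yangian of `gl_n`:
`((u−v) • 1 − P_{1,2}) T_1(u) T_2(v) = T_2(v) T_1(u) ((u−v) • 1 − P_{1,2})`
in the 2-leg model. -/
def RTT (T : ℂ → Matrix (Fin n) (Fin n) A) : Prop :=
  ∀ u v : ℂ,
    ((u - v) • (1 : LegMatrix n 2 A) - Pleg n A (legSwap 2 1 2)) *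
        Tleg T (0 : Fin 2) u * Tleg T (1 : Fin 2) v =
      Tleg T (1 : Fin 2) v * Tleg T (0 : Fin 2) u *
        ((u - v) • (1 : LegMatrix n 2 A) - Pleg n A (legSwap 2 1 2))

/-- The elementary symmetric function
`e_k(u) = trace(A_k * T_1(u) * T_2(u−1) * ⋯ * T_k(u−k+1))`; for `k = 0` this is `1`. -/
noncomputable def esym (T : ℂ → Matrix (Fin n) (Fin n) A) (k : ℕ) (u : ℂ) : A :=
  Matrix.trace (Aleg n A k * TT T k u (-1))

/-- The homogeneous symmetric function
`h_k(u) = trace(S_k * T_1(u) * T_2(u+1) * ⋯ * T_k(u+k−1))`; for `k = 0` this is `1`. -/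
noncomputable def hsym (T : ℂ → Matrix (Fin n) (Fin n) A) (k : ℕ) (u : ℂ) : A :=
  Matrix.trace (Sleg n A k * TT T k u 1)

/-- The power sum `p⁻_k(u) = trace(T(u) * T(u−1) * ⋯ * T(u−k+1))`,
an ordinary product of `n×n` matrices over `A`. -/
noncomputable def pminus (T : ℂ → Matrix (Fin n) (Fin n) A) (k : ℕ) (u : ℂ) : A :=
  Matrix.trace (((List.finRange k).map (fun i => T (u - ((i : ℕ) : ℂ)))).prod)

/-- The power sum `p⁺_k(u) = trace(T(u) * T(u+1) * ⋯ * T(u+k−1))`,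
an ordinary product of `n×n` matrices over `A`. -/
noncomputable def pplus (T : ℂ → Matrix (Fin n) (Fin n) A) (k : ℕ) (u : ℂ) : A :=
  Matrix.trace (((List.finRange k).map (fun i => T (u + ((i : ℕ) : ℂ)))).prod)

set_option linter.unusedSectionVars false

/-- The ordered product `M 0 (f 0) (g 0) * ⋯ * M (j-1) (f (j-1)) (g (j-1))`. -/
def entryProd (M : ℕ → Matrix (Fin n) (Fin n) A) (j : ℕ) (f g : Fin j → Fin n) : A :=
  (List.ofFn fun s : Fin j => M s (f s) (g s)).prod

/-- The entrywise form of the RTT relation at spectral parameters differing by one, for a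
sequence of matrices. -/
def SymExchange (M : ℕ → Matrix (Fin n) (Fin n) A) : Prop :=
  ∀ i a b c d, M i a c * M (i + 1) b d + M i b c * M (i + 1) a d =
    M i a d * M (i + 1) b c + M i b d * M (i + 1) a c

theorem entryProd_succ (M : ℕ → Matrix (Fin n) (Fin n) A) (j : ℕ) (f g : Fin (j + 1) → Fin n) :
    entryProd M (j + 1) f g = entryProd M j (f ∘ Fin.castSucc) (g ∘ Fin.castSucc) *
      M j (f (Fin.last j)) (g (Fin.last j)) := by
  simp only [entryProd, List.ofFn_succ', List.concat_eq_append, List.prod_append,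
    List.prod_singleton]
  rfl

theorem swap_comp_castSucc {j : ℕ} (a b : Fin j) (f : Fin (j + 1) → Fin n) :
    (f ∘ Equiv.swap a.castSucc b.castSucc) ∘ Fin.castSucc =
      (f ∘ Fin.castSucc) ∘ Equiv.swap a b := by
  funext s
  simp only [Function.comp_apply]
  congr 1
  exact ((Fin.castSucc_injective j).map_swap a b s).symm

theorem swap_castSucc_last {j : ℕ} (a b : Fin j) :
    Equiv.swap a.castSucc b.castSucc (Fin.last j) = Fin.last j :=
  Equiv.swap_apply_of_ne_of_ne (Fin.castSucc_lt_last a).ne' (Fin.castSucc_lt_last b).ne'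

theorem entryProd_swap {M : ℕ → Matrix (Fin n) (Fin n) A} (hM : SymExchange M) {j : ℕ}
    (i : Fin j) (f g : Fin (j + 1) → Fin n) :
    entryProd M (j + 1) f g + entryProd M (j + 1) (f ∘ Equiv.swap i.castSucc i.succ) g =
      entryProd M (j + 1) f (g ∘ Equiv.swap i.castSucc i.succ) +
        entryProd M (j + 1) (f ∘ Equiv.swap i.castSucc i.succ)
          (g ∘ Equiv.swap i.castSucc i.succ) := by
  induction j with
  | zero => exact i.elim0
  | succ j ih =>
    induction i using Fin.lastCases with
    | last =>
      have fix (h : Fin (j + 2) → Fin n) :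
          ((h ∘ Equiv.swap (Fin.last j).castSucc (Fin.last (j + 1))) ∘ Fin.castSucc) ∘
            Fin.castSucc = (h ∘ Fin.castSucc) ∘ Fin.castSucc := by
        funext s
        simp only [Function.comp_apply]
        rw [Equiv.swap_apply_of_ne_of_ne]
        · exact fun e => (Fin.castSucc_lt_last s).ne (Fin.castSucc_injective _ e)
        · exact (Fin.castSucc_lt_last _).ne
      simp only [Fin.succ_last, entryProd_succ, fix, Function.comp_apply, Equiv.swap_apply_left,
        Equiv.swap_apply_right, mul_assoc, ← mul_add]
      rw [hM]
    | cast i =>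
      rw [Fin.succ_castSucc]
      simp only [entryProd_succ M (j + 1), swap_comp_castSucc, Function.comp_apply,
        swap_castSucc_last, ← add_mul]
      rw [ih]

/-- The sum of `entryProd` over all permutations of the row indices. -/
def symEntryProd (M : ℕ → Matrix (Fin n) (Fin n) A) (j : ℕ) (f g : Fin j → Fin n) : A :=
  ∑ ρ : Equiv.Perm (Fin j), entryProd M j (f ∘ ρ) g

theorem symEntryProd_comp_left (M : ℕ → Matrix (Fin n) (Fin n) A) {j : ℕ} (f g : Fin j → Fin n)
    (y : Equiv.Perm (Fin j)) : symEntryProd M j (f ∘ y) g = symEntryProd M j f g :=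
  Fintype.sum_equiv (Equiv.mulLeft y) _ _ fun _ => rfl

theorem symEntryProd_comp_swap {M : ℕ → Matrix (Fin n) (Fin n) A} (hM : SymExchange M) {j : ℕ}
    (i : Fin j) (f g : Fin (j + 1) → Fin n) :
    symEntryProd M (j + 1) f (g ∘ Equiv.swap i.castSucc i.succ) =
      symEntryProd M (j + 1) f g := by
  set s := Equiv.swap i.castSucc i.succ with hs
  have double (h : Fin (j + 1) → Fin n) : symEntryProd M (j + 1) f h + symEntryProd M (j + 1) f h =
      ∑ ρ : Equiv.Perm (Fin (j + 1)), (entryProd M (j + 1) (f ∘ ρ) h +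
        entryProd M (j + 1) ((f ∘ ρ) ∘ s) h) := by
    rw [Finset.sum_add_distrib]
    congr 1
    exact (Fintype.sum_equiv (Equiv.mulRight s) _ _ fun _ => rfl).symm
  have key : symEntryProd M (j + 1) f g + symEntryProd M (j + 1) f g =
      symEntryProd M (j + 1) f (g ∘ s) + symEntryProd M (j + 1) f (g ∘ s) := by
    rw [double, double]
    exact Finset.sum_congr rfl fun ρ _ => entryProd_swap hM i _ _
  rw [← two_smul ℂ, ← two_smul ℂ] at key
  exact (smul_right_injective A (two_ne_zero' ℂ) key).symm

theorem symEntryProd_comp_right {M : ℕ → Matrix (Fin n) (Fin n) A} (hM : SymExchange M) {j : ℕ}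
    (f g : Fin j → Fin n) (y : Equiv.Perm (Fin j)) :
    symEntryProd M j f (g ∘ y) = symEntryProd M j f g := by
  cases j with
  | zero => rw [Subsingleton.elim (g ∘ y) g]
  | succ j =>
    have hy : y ∈ Submonoid.closure
        (Set.range fun i : Fin j => Equiv.swap i.castSucc i.succ) := by
      rw [Equiv.Perm.mclosure_swap_castSucc_succ]; trivial
    induction hy using Submonoid.closure_induction generalizing g with
    | mem x hx => obtain ⟨i, rfl⟩ := hx; exact symEntryProd_comp_swap hM i f g
    | one => rfl
    | mul x y _ _ hx hy => exact (hy (g ∘ x)).trans (hx g)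

/-- The unnormalized symmetrized trace on `j + 1` legs of `M 0, …, M (j-1)` on the first `j` legs
and `N` on the last one. -/
def symTrace (M : ℕ → Matrix (Fin n) (Fin n) A) (j : ℕ) (N : Matrix (Fin n) (Fin n) A) : A :=
  ∑ ρ : Equiv.Perm (Fin (j + 1)), ∑ g : Fin (j + 1) → Fin n,
    entryProd M j (g ∘ Fin.castSucc) (g ∘ ρ ∘ Fin.castSucc) *
      N (g (Fin.last j)) (g (ρ (Fin.last j)))

/-- The unnormalized homogeneous symmetric function of a sequence of matrices. -/
def symTraceFull (M : ℕ → Matrix (Fin n) (Fin n) A) (j : ℕ) : A :=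
  ∑ ρ : Equiv.Perm (Fin j), ∑ g : Fin j → Fin n, entryProd M j g (g ∘ ρ)

theorem symTraceFull_succ (M : ℕ → Matrix (Fin n) (Fin n) A) (j : ℕ) :
    symTraceFull M (j + 1) = symTrace M j (M j) := by
  simp only [symTraceFull, symTrace, entryProd_succ]
  rfl

theorem sum_perm_fin_succ {B : Type*} [AddCommMonoid B] {j : ℕ}
    (F : (Fin (j + 1) → Fin (j + 1)) → B) :
    ∑ ρ : Equiv.Perm (Fin (j + 1)), F ρ =
      ∑ e : Equiv.Perm (Fin j), F (Fin.snoc (Fin.castSucc ∘ e) (Fin.last j)) +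
      ∑ i : Fin j, ∑ e : Equiv.Perm (Fin j),
        F (Fin.snoc (Function.update (Fin.castSucc ∘ e) i (Fin.last j)) (e i).castSucc) := by
  have h : ∑ ρ : Equiv.Perm (Fin (j + 1)), F ρ =
      ∑ p : Option (Fin j) × Equiv.Perm (Fin j),
        F ((finSuccEquivLast.symm.permCongr
          (Equiv.Perm.decomposeOption.symm (p.1, p.2⁻¹)))⁻¹ : Equiv.Perm (Fin (j + 1))) := by
    refine (Fintype.sum_equiv
      (((Equiv.prodCongr (Equiv.refl _) (Equiv.inv _)).trans
        (Equiv.Perm.decomposeOption.symm.trans finSuccEquivLast.symm.permCongr)).trans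
          (Equiv.inv _)) _ _ fun p => rfl).symm
  rw [h, Fintype.sum_prod_type, Fintype.sum_option]
  congr 1
  · refine Finset.sum_congr rfl fun e _ => congrArg F ?_
    funext s
    induction s using Fin.lastCases with
    | last => simp [Equiv.permCongr_def, Equiv.Perm.inv_def, Equiv.Perm.mul_def]
    | cast s => simp [Equiv.permCongr_def, Equiv.Perm.inv_def, Equiv.Perm.mul_def]
  · refine Finset.sum_congr rfl fun i _ => Finset.sum_congr rfl fun e _ => congrArg F ?_
    funext s
    induction s using Fin.lastCases with
    | last => simp [Equiv.permCongr_def, Equiv.Perm.inv_def, Equiv.Perm.mul_def]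
    | cast s =>
      by_cases hs : s = i
      · subst hs; simp [Equiv.permCongr_def, Equiv.Perm.inv_def, Equiv.Perm.mul_def]
      · simp [Equiv.permCongr_def, Equiv.Perm.inv_def, Equiv.Perm.mul_def, Equiv.swap_apply_of_ne_of_ne, hs]

theorem sum_fin_succ_fun {B : Type*} [AddCommMonoid B] {j : ℕ}
    (F : (Fin (j + 1) → Fin n) → B) :
    ∑ g : Fin (j + 1) → Fin n, F g = ∑ g : Fin j → Fin n, ∑ a : Fin n,
      F (Fin.snoc g a) := by
  rw [← Fintype.sum_prod_type', ← (Fin.snocEquiv fun _ => Fin n).sum_comp,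
    ← (Equiv.prodComm _ _).sum_comp]
  rfl

theorem sum_entryProd_update (M : ℕ → Matrix (Fin n) (Fin n) A) {j : ℕ}
    (N : Matrix (Fin n) (Fin n) A) (i : Fin j) :
    ∑ e : Equiv.Perm (Fin j), ∑ g : Fin j → Fin n, ∑ a,
        entryProd M j g (Function.update (g ∘ e) i a) * N a (g (e i)) =
      ∑ g : Fin j → Fin n, ∑ a, symEntryProd M j g (Function.update g i a) * N a (g i) := by
  simp only [symEntryProd, Finset.sum_mul]
  have h (e : Equiv.Perm (Fin j)) : ∑ g : Fin j → Fin n, ∑ a,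
        entryProd M j g (Function.update (g ∘ e) i a) * N a (g (e i)) =
      ∑ g : Fin j → Fin n, ∑ a,
        entryProd M j (g ∘ e.symm) (Function.update g i a) * N a (g i) := by
    refine Fintype.sum_equiv (Equiv.arrowCongr e.symm (Equiv.refl _)) _ _ fun g => ?_
    refine Finset.sum_congr rfl fun a _ => ?_
    congr 2
    funext s
    simp [Equiv.arrowCongr]
  simp only [h]
  rw [Finset.sum_comm]
  refine Finset.sum_congr rfl fun g _ => ?_
  rw [Finset.sum_comm]
  exact Finset.sum_congr rfl fun a _ => Fintype.sum_equiv (Equiv.inv _) _ _ fun e => rfl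

theorem sum_symEntryProd_update {M : ℕ → Matrix (Fin n) (Fin n) A} (hM : SymExchange M) {j : ℕ}
    (N : Matrix (Fin n) (Fin n) A) (i k : Fin j) :
    ∑ g : Fin j → Fin n, ∑ a, symEntryProd M j g (Function.update g i a) * N a (g i) =
      ∑ g : Fin j → Fin n, ∑ a, symEntryProd M j g (Function.update g k a) * N a (g k) := by
  refine Fintype.sum_equiv (Equiv.arrowCongr (Equiv.swap i k) (Equiv.refl _)) _ _ fun g => ?_
  refine Finset.sum_congr rfl fun a _ => ?_
  have hg : (Equiv.arrowCongr (Equiv.swap i k) (Equiv.refl (Fin n))) g = g ∘ Equiv.swap i k := by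
    funext s; simp [Equiv.arrowCongr]
  have hu : Function.update (g ∘ Equiv.swap i k) k a =
      Function.update g i a ∘ Equiv.swap i k := by
    rw [Function.update_comp_equiv]; simp
  rw [hg, hu, symEntryProd_comp_left, symEntryProd_comp_right hM]
  simp

theorem symTrace_succ {M : ℕ → Matrix (Fin n) (Fin n) A} (hM : SymExchange M) (j : ℕ)
    (N : Matrix (Fin n) (Fin n) A) :
    symTrace M (j + 1) N = symTraceFull M (j + 1) * N.trace +
      ((j : ℂ) + 1) • symTrace M j (M j * N) := by
  rw [symTrace, sum_perm_fin_succ fun ρ => ∑ g : Fin (j + 1 + 1) → Fin n,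
    entryProd M (j + 1) (g ∘ Fin.castSucc) (g ∘ ρ ∘ Fin.castSucc) *
      N (g (Fin.last (j + 1))) (g (ρ (Fin.last (j + 1))))]
  congr 1
  · rw [symTraceFull, Finset.sum_mul]
    refine Finset.sum_congr rfl fun e _ => ?_
    rw [sum_fin_succ_fun, Finset.sum_mul]
    refine Finset.sum_congr rfl fun g _ => ?_
    rw [Matrix.trace, Finset.mul_sum]
    refine Finset.sum_congr rfl fun a _ => ?_
    simp [Function.comp_def]
  · have step (i : Fin (j + 1)) : ∑ e : Equiv.Perm (Fin (j + 1)), ∑ g : Fin (j + 1 + 1) → Fin n,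
        entryProd M (j + 1) (g ∘ Fin.castSucc)
          (g ∘ (Fin.snoc (Function.update (Fin.castSucc ∘ e) i (Fin.last (j + 1)))
            (e i).castSucc : Fin (j + 1 + 1) → Fin (j + 1 + 1)) ∘ Fin.castSucc) *
          N (g (Fin.last (j + 1)))
            (g ((Fin.snoc (Function.update (Fin.castSucc ∘ e) i (Fin.last (j + 1)))
              (e i).castSucc : Fin (j + 1 + 1) → Fin (j + 1 + 1)) (Fin.last (j + 1)))) =
        ∑ e : Equiv.Perm (Fin (j + 1)), ∑ g : Fin (j + 1) → Fin n, ∑ a,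
          entryProd M (j + 1) g (Function.update (g ∘ e) i a) * N a (g (e i)) := by
      refine Finset.sum_congr rfl fun e _ => ?_
      rw [sum_fin_succ_fun]
      refine Finset.sum_congr rfl fun g _ => Finset.sum_congr rfl fun a _ => ?_
      congr 2
      · funext s; simp
      · funext s
        by_cases hs : s = i
        · subst hs; simp
        · simp [hs]
      · simp
      · simp
    simp only [step, sum_entryProd_update]
    rw [Finset.sum_congr rfl fun i _ => sum_symEntryProd_update hM N i (Fin.last j)]
    rw [Finset.sum_const, ← sum_entryProd_update, Finset.card_univ, Fintype.card_fin,
      ← Nat.cast_smul_eq_nsmul ℂ, Nat.cast_succ, symTrace]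
    congr 1
    refine Finset.sum_congr rfl fun e _ => Finset.sum_congr rfl fun g _ => ?_
    rw [Matrix.mul_apply, Finset.mul_sum]
    refine Finset.sum_congr rfl fun a _ => ?_
    rw [entryProd_succ, mul_assoc]
    congr 2
    · funext s
      simp [(Fin.castSucc_lt_last s).ne]
    · simp

/-- The product `M k * M (k + 1) * ⋯ * M (k + l - 1)`. -/
def consecProd (M : ℕ → Matrix (Fin n) (Fin n) A) (k l : ℕ) : Matrix (Fin n) (Fin n) A :=
  (List.ofFn fun i : Fin l => M (k + i)).prod

theorem consecProd_succ (M : ℕ → Matrix (Fin n) (Fin n) A) (k l : ℕ) :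
    consecProd M k (l + 1) = M k * consecProd M (k + 1) l := by
  simp [consecProd, List.ofFn_succ, Nat.add_assoc, Nat.add_comm 1]

theorem symTrace_zero (M : ℕ → Matrix (Fin n) (Fin n) A) (N : Matrix (Fin n) (Fin n) A) :
    symTrace M 0 N = N.trace := by
  have : Subsingleton (Equiv.Perm (Fin (0 + 1))) :=
    inferInstanceAs (Subsingleton (Equiv.Perm (Fin 1)))
  rw [symTrace, Fintype.sum_subsingleton _ 1, sum_fin_succ_fun, Fintype.sum_unique]
  simp [entryProd, Matrix.trace, Fin.snoc]

theorem symTrace_consecProd {M : ℕ → Matrix (Fin n) (Fin n) A} (hM : SymExchange M) (j l : ℕ) :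
    (j.factorial : ℂ)⁻¹ • symTrace M j (consecProd M j (l + 1)) =
      ∑ k ∈ Finset.range (j + 1), ((k.factorial : ℂ)⁻¹ • symTraceFull M k) *
        (consecProd M k (j + l + 1 - k)).trace := by
  induction j generalizing l with
  | zero => simp [symTrace_zero, symTraceFull, entryProd]
  | succ j ih =>
    have hj : (j : ℂ) + 1 ≠ 0 := Nat.cast_add_one_ne_zero j
    have e : j + (l + 1) + 1 = j + 1 + l + 1 := by omega
    have e_sub : j + 1 + l + 1 - (j + 1) = l + 1 := by omega
    rw [Finset.sum_range_succ, symTrace_succ hM, ← consecProd_succ, smul_add, smul_smul,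
      Nat.factorial_succ, add_comm, ← e, ← ih (l + 1), e, e_sub, smul_mul_assoc]
    congr 2
    push_cast
    field_simp

theorem prod_map_Tleg_apply (T : ℂ → Matrix (Fin n) (Fin n) A) {k : ℕ} (v : Fin k → ℂ)
    (L : List (Fin k)) (hL : L.Nodup) (f g : Fin k → Fin n) :
    (L.map fun s => Tleg T s (v s)).prod f g =
      if ∀ t, t ∉ L → f t = g t then (L.map fun s => T (v s) (f s) (g s)).prod else 0 := by
  induction L generalizing f with
  | nil => simp [Matrix.one_apply, funext_iff]
  | cons a L ih =>
    obtain ⟨ha, hL⟩ := List.nodup_cons.mp hL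
    rw [List.map_cons, List.prod_cons, Matrix.mul_apply,
      Finset.sum_eq_single (Function.update f a (g a))]
    · have h1 : Tleg T a (v a) f (Function.update f a (g a)) = T (v a) (f a) (g a) := by
        rw [Tleg, if_pos fun t ht => by simp [ht]]; simp
      have h2 : (L.map fun s => T (v s) (Function.update f a (g a) s) (g s)) =
          L.map fun s => T (v s) (f s) (g s) :=
        List.map_congr_left fun s hs => by
          rw [Function.update_of_ne]; rintro rfl; exact ha hs
      have h3 : (∀ t, t ∉ L → Function.update f a (g a) t = g t) ↔
          ∀ t, t ∉ a :: L → f t = g t := by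
        refine forall_congr' fun t => ?_
        by_cases ht : t = a
        · subst ht; simp
        · simp [ht]
      rw [ih hL, h1, h2]
      simp only [h3, mul_ite, mul_zero, List.map_cons, List.prod_cons]
    · intro h _ hne
      rw [ih hL, Tleg]
      by_cases h1 : ∀ t, t ≠ a → f t = h t
      · suffices h2 : ¬ ∀ t, t ∉ L → h t = g t by rw [if_neg h2, mul_zero]
        intro h2
        apply hne
        funext t
        by_cases ht : t = a
        · subst ht; simp [h2 t ha]
        · simp [ht, h1 t ht]
      · rw [if_neg h1, zero_mul]
    · simp

theorem TT_one_apply (T : ℂ → Matrix (Fin n) (Fin n) A) (k : ℕ) (u : ℂ) (f g : Fin k → Fin n) :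
    TT T k u 1 f g = entryProd (fun i => T (u + i)) k f g := by
  rw [TT, prod_map_Tleg_apply T (fun s : Fin k => u + 1 * ((s : ℕ) : ℂ)) _ (List.nodup_finRange k)]
  simp [entryProd, List.ofFn_eq_map]

theorem Pleg_mul_apply {k : ℕ} (σ : Equiv.Perm (Fin k)) (X : LegMatrix n k A)
    (f g : Fin k → Fin n) : (Pleg n A σ * X) f g = X (f ∘ σ.symm) g := by
  have h (x : Fin k → Fin n) : f = x ∘ σ ↔ f ∘ σ.symm = x := (Equiv.comp_symm_eq σ x f).symm
  simp [Matrix.mul_apply, Pleg, h]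

theorem mul_Pleg_apply {k : ℕ} (σ : Equiv.Perm (Fin k)) (X : LegMatrix n k A)
    (f g : Fin k → Fin n) : (X * Pleg n A σ) f g = X f (g ∘ σ) := by
  simp [Matrix.mul_apply, Pleg]

theorem hsym_eq_symTraceFull (T : ℂ → Matrix (Fin n) (Fin n) A) (k : ℕ) (u : ℂ) :
    hsym T k u = (k.factorial : ℂ)⁻¹ • symTraceFull (fun i => T (u + i)) k := by
  rw [hsym, Sleg, smul_mul_assoc, Matrix.trace_smul, Finset.sum_mul, Matrix.trace_sum]
  congr 1
  refine Finset.sum_congr rfl fun σ _ => ?_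
  refine Fintype.sum_equiv (Equiv.arrowCongr σ (Equiv.refl _)) _ _ fun f => ?_
  rw [Matrix.diag_apply, Pleg_mul_apply, TT_one_apply]
  congr 1
  funext s
  simp [Equiv.arrowCongr]

theorem pplus_eq_trace_consecProd (T : ℂ → Matrix (Fin n) (Fin n) A) (k l : ℕ) (u : ℂ) :
    pplus T l (u + k) = (consecProd (fun i => T (u + i)) k l).trace := by
  have h : (List.finRange l).map (fun i : Fin l => T (u + ((k + (i : ℕ) : ℕ) : ℂ))) =
      (List.range l).map fun i => T (u + ((k + i : ℕ) : ℂ)) := by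
    rw [← List.map_coe_finRange_eq_range, List.map_map]
    rfl
  rw [consecProd, List.ofFn_eq_map, h]
  simp [pplus, add_assoc, ← List.map_eq_flatMap]

theorem RTT.symExchange {T : ℂ → Matrix (Fin n) (Fin n) A} (hT : RTT T) (u : ℂ) :
    SymExchange fun i => T (u + i) := by
  intro i a b c d
  have hs : legSwap 2 1 2 = Equiv.swap (0 : Fin 2) 1 := by simp [legSwap]
  have comp_swap (x y : Fin n) : ![x, y] ∘ Equiv.swap (0 : Fin 2) 1 = ![y, x] := by
    funext s; fin_cases s <;> simp
  have h01 (v w : ℂ) (x y z t : Fin n) :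
      (Tleg T (0 : Fin 2) v * Tleg T (1 : Fin 2) w) ![x, y] ![z, t] = T v x z * T w y t := by
    have := prod_map_Tleg_apply T ![v, w] [0, 1] (by simp) ![x, y] ![z, t]
    rw [if_pos (fun t ht => by fin_cases t <;> simp at ht)] at this
    simpa using this
  have key (x y z t : Fin n) : T (u + i) x z * T (u + (i + 1)) y t +
      T (u + i) y z * T (u + (i + 1)) x t =
      (Tleg T (1 : Fin 2) (u + (i + 1)) * Tleg T (0 : Fin 2) (u + i)) ![x, y] ![z, t] +
      (Tleg T (1 : Fin 2) (u + (i + 1)) * Tleg T (0 : Fin 2) (u + i)) ![x, y] ![t, z] := by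
    have h := congrFun (congrFun (hT (u + i) (u + (i + 1))) ![x, y]) ![z, t]
    rw [hs, mul_assoc, sub_mul, mul_sub, Matrix.sub_apply, Matrix.sub_apply, Pleg_mul_apply,
      mul_Pleg_apply, Equiv.symm_swap, comp_swap, comp_swap, h01] at h
    have e : u + (i : ℂ) - (u + (i + 1)) = -1 := by ring
    simp only [e, neg_smul, one_smul, neg_mul, one_mul, mul_neg, mul_one, Matrix.neg_apply,
      h01] at h
    rw [← neg_inj, neg_add, neg_add, ← sub_eq_add_neg, ← sub_eq_add_neg]
    exact h
  push_cast
  rw [key, key a b d c, add_comm]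

/-- Newton's identity for Yangian homogeneous symmetric functions:
`Σ_{k=0}^{m−1} h_k(u) p⁺_{m−k}(u+k) = m • h_m(u)`. -/
theorem newton_hsym (hn : 1 ≤ n) (T : ℂ → Matrix (Fin n) (Fin n) A)
    (hT : RTT T) (m : ℕ) (hm : 1 ≤ m) (u : ℂ) :
    ∑ k ∈ Finset.range m, hsym T k u * pplus T (m - k) (u + (k : ℂ)) =
      (m : ℂ) • hsym T m u := by
  obtain ⟨j, rfl⟩ := Nat.exists_eq_add_of_le' hm
  have hj : (j : ℂ) + 1 ≠ 0 := Nat.cast_add_one_ne_zero j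
  have h := symTrace_consecProd (hT.symExchange u) j 0
  simp only [hsym_eq_symTraceFull, pplus_eq_trace_consecProd]
  rw [add_zero] at h
  rw [← h, symTraceFull_succ, smul_smul, consecProd_succ, Nat.factorial_succ]
  congr 1
  · push_cast
    field_simp
  · simp [consecProd]
end

section
/- For every m ≥ 1 and u ∈ ℂ, m! • e_m(u) equals the row-determinant Σ_{σ ∈ S_m} sgn(σ) M_{1,σ(1)} * M_{2,σ(2)} * ⋯ * M_{m,σ(m)} (factors multiplied in increasing row order) of the m×m matrix M over A whose entries are: M_{i,j} = p⁻_{i−j+1}(u−j+1) for 1 ≤ j ≤ i ≤ m, M_{i,i+1} = i • 1_A, and M_{i,j} = 0 for j > i+1. -/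
variable {n : ℕ} {A : Type*} [Ring A] [Algebra ℂ A]

section

open Equiv Equiv.Perm

/-- The permutations of `Fin m` fixing every index `≥ j`. -/
def permsBelow (m j : ℕ) : Finset (Perm (Fin m)) :=
  Finset.univ.filter fun τ => ∀ i : Fin m, j ≤ (i : ℕ) → τ i = i

theorem mem_permsBelow {m j : ℕ} {τ : Perm (Fin m)} :
    τ ∈ permsBelow m j ↔ ∀ i : Fin m, j ≤ (i : ℕ) → τ i = i := by
  simp [permsBelow]

theorem permsBelow_self (m : ℕ) : permsBelow m m = Finset.univ := by
  ext τ
  simp only [mem_permsBelow, Finset.mem_univ, iff_true]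
  intro i hi
  omega

theorem mul_mem_permsBelow {m j : ℕ} {σ τ : Perm (Fin m)} (hσ : σ ∈ permsBelow m j)
    (hτ : τ ∈ permsBelow m j) : σ * τ ∈ permsBelow m j := by
  rw [mem_permsBelow] at *
  intro i hi
  rw [Perm.mul_apply, hτ i hi, hσ i hi]

theorem inv_mem_permsBelow {m j : ℕ} {σ : Perm (Fin m)} (hσ : σ ∈ permsBelow m j) :
    σ⁻¹ ∈ permsBelow m j := by
  rw [mem_permsBelow] at *
  intro i hi
  rw [Perm.inv_eq_iff_eq, hσ i hi]

theorem swap_mem_permsBelow {m j : ℕ} {a b : Fin m} (ha : (a : ℕ) < j) (hb : (b : ℕ) < j) :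
    swap a b ∈ permsBelow m j := by
  rw [mem_permsBelow]
  intro i hi
  exact swap_apply_of_ne_of_ne (by rintro rfl; omega) (by rintro rfl; omega)

theorem permsBelow_mono {m j k : ℕ} (h : j ≤ k) : permsBelow m j ⊆ permsBelow m k := by
  intro τ
  rw [mem_permsBelow, mem_permsBelow]
  exact fun hτ i hi => hτ i (h.trans hi)

/-- Left coset decomposition of the permutations of `j + 1` letters. -/
theorem sum_permsBelow_succ {B : Type*} [AddCommMonoid B] {m : ℕ} (j : Fin m)
    (g : Perm (Fin m) → B) :
    ∑ σ ∈ permsBelow m (j + 1), g σ =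
      ∑ i ∈ Finset.univ.filter (fun i : Fin m => i ≤ j),
        ∑ τ ∈ permsBelow m j, g (swap i j * τ) := by
  rw [← Finset.sum_product']
  symm
  refine Finset.sum_bij' (fun p _ => swap p.1 j * p.2) (fun σ _ => (σ j, swap (σ j) j * σ))
    ?_ ?_ ?_ ?_ ?_
  · rintro ⟨i, τ⟩ h
    simp only [Finset.mem_product, Finset.mem_filter, Finset.mem_univ, true_and] at h
    exact mul_mem_permsBelow (swap_mem_permsBelow (Nat.lt_succ_of_le h.1) (by omega))
      (permsBelow_mono (by omega) h.2)
  · intro σ hσ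
    rw [mem_permsBelow] at hσ
    simp only [Finset.mem_product, Finset.mem_filter, Finset.mem_univ, true_and, mem_permsBelow]
    have hle : σ j ≤ j := by
      by_contra hlt
      have h1 := hσ (σ j) (by omega)
      exact hlt (le_of_eq (σ.injective h1))
    refine ⟨hle, fun i hi => ?_⟩
    rw [Perm.mul_apply]
    rcases eq_or_lt_of_le hi with h | h
    · obtain rfl : j = i := Fin.ext h
      exact swap_apply_left _ _
    · rw [hσ i h]
      exact swap_apply_of_ne_of_ne (by rintro rfl; omega) (by rintro rfl; omega)
  · rintro ⟨i, τ⟩ h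
    simp only [Finset.mem_product, mem_permsBelow] at h
    have hj : τ j = j := h.2 j le_rfl
    simp [hj, ← mul_assoc]
  · intro σ _
    simp [← mul_assoc]
  · intros
    rfl

theorem sum_permsBelow_inv {B : Type*} [AddCommMonoid B] (m j : ℕ) (g : Perm (Fin m) → B) :
    ∑ σ ∈ permsBelow m j, g σ⁻¹ = ∑ σ ∈ permsBelow m j, g σ :=
  Finset.sum_bij' (fun σ _ => σ⁻¹) (fun σ _ => σ⁻¹) (fun _ h => inv_mem_permsBelow h)
    (fun _ h => inv_mem_permsBelow h) (fun _ _ => inv_inv _) (fun _ _ => inv_inv _)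
    (fun _ _ => rfl)

/-- Right coset decomposition of the permutations of `j + 1` letters. -/
theorem sum_permsBelow_succ_right {B : Type*} [AddCommMonoid B] {m : ℕ} (j : Fin m)
    (g : Perm (Fin m) → B) :
    ∑ σ ∈ permsBelow m (j + 1), g σ =
      ∑ i ∈ Finset.univ.filter (fun i : Fin m => i ≤ j),
        ∑ τ ∈ permsBelow m j, g (τ * swap i j) := by
  rw [← sum_permsBelow_inv, sum_permsBelow_succ]
  refine Finset.sum_congr rfl fun i _ => ?_
  rw [← sum_permsBelow_inv]
  simp

theorem sum_permsBelow_mul_right {B : Type*} [AddCommMonoid B] {m j : ℕ} {ρ : Perm (Fin m)}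
    (hρ : ρ ∈ permsBelow m j) (g : Perm (Fin m) → B) :
    ∑ τ ∈ permsBelow m j, g (τ * ρ) = ∑ τ ∈ permsBelow m j, g τ :=
  Finset.sum_bij' (fun τ _ => τ * ρ) (fun τ _ => τ * ρ⁻¹) (fun _ h => mul_mem_permsBelow h hρ)
    (fun _ h => mul_mem_permsBelow h (inv_mem_permsBelow hρ)) (fun _ _ => by simp)
    (fun _ _ => by simp) (fun _ _ => rfl)

theorem sum_permsBelow_mul_left {B : Type*} [AddCommMonoid B] {m j : ℕ} {ρ : Perm (Fin m)}
    (hρ : ρ ∈ permsBelow m j) (g : Perm (Fin m) → B) :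
    ∑ τ ∈ permsBelow m j, g (ρ * τ) = ∑ τ ∈ permsBelow m j, g τ :=
  Finset.sum_bij' (fun τ _ => ρ * τ) (fun τ _ => ρ⁻¹ * τ) (fun _ h => mul_mem_permsBelow hρ h)
    (fun _ h => mul_mem_permsBelow (inv_mem_permsBelow hρ) h) (fun _ _ => by simp)
    (fun _ _ => by simp) (fun _ _ => rfl)

/-- Extension of a permutation of the first `a` letters by the identity on the last `b`. -/
def extendPerm {a : ℕ} (b : ℕ) (τ : Perm (Fin a)) : Perm (Fin (a + b)) :=
  finSumFinEquiv.permCongr (Perm.sumCongr τ 1)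

theorem extendPerm_castAdd {a b : ℕ} (τ : Perm (Fin a)) (i : Fin a) :
    extendPerm b τ (Fin.castAdd b i) = Fin.castAdd b (τ i) := by
  simp [extendPerm, permCongr_apply]

theorem extendPerm_natAdd {a b : ℕ} (τ : Perm (Fin a)) (i : Fin b) :
    extendPerm b τ (Fin.natAdd a i) = Fin.natAdd a i := by
  simp [extendPerm, permCongr_apply]

theorem sign_extendPerm {a : ℕ} (b : ℕ) (τ : Perm (Fin a)) :
    sign (extendPerm b τ) = sign τ := by
  simp [extendPerm]

theorem sum_permsBelow_extendPerm {B : Type*} [AddCommMonoid B] (a b : ℕ)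
    (g : Perm (Fin (a + b)) → B) :
    ∑ σ ∈ permsBelow (a + b) a, g σ = ∑ τ : Perm (Fin a), g (extendPerm b τ) := by
  symm
  refine Finset.sum_bij (fun τ _ => extendPerm b τ) ?_ ?_ ?_ (fun _ _ => rfl)
  · intro τ _
    rw [mem_permsBelow]
    intro i
    refine Fin.addCases (fun i hi => ?_) (fun i _ => extendPerm_natAdd τ i) i
    simp only [Fin.val_castAdd] at hi
    omega
  · intro σ _ τ _ h
    ext i
    have := congrArg (fun ρ => ((ρ (Fin.castAdd b i) : Fin (a + b)) : ℕ)) h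
    simpa [extendPerm_castAdd] using this
  · intro σ hσ
    rw [mem_permsBelow] at hσ
    have hlt : ∀ i : Fin (a + b), (i : ℕ) < a ↔ (σ i : ℕ) < a := by
      intro i
      constructor
      · intro hi
        by_contra hge
        have := σ.injective (hσ (σ i) (by omega))
        rw [this] at hge
        omega
      · intro hi
        by_contra hge
        rw [hσ i (by omega)] at hi
        omega
    let e : Fin a ≃ {i : Fin (a + b) // (i : ℕ) < a} :=
      { toFun := fun i => ⟨Fin.castAdd b i, i.2⟩
        invFun := fun i => ⟨i.1, i.2⟩
        left_inv := fun _ => rfl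
        right_inv := fun _ => rfl }
    refine ⟨e.symm.permCongr (σ.subtypePerm fun i => (hlt i).symm), Finset.mem_univ _, ?_⟩
    ext i
    refine Fin.addCases (fun i => ?_) (fun i => ?_) i
    · rw [extendPerm_castAdd]
      rfl
    · rw [extendPerm_natAdd, hσ]
      simp

/-- The cycle `j ↦ m - 1 ↦ m - 2 ↦ ⋯ ↦ j` of `Fin m`, fixing the indices below `j`. -/
def tailCycle (m j : ℕ) : Perm (Fin m) where
  toFun i := if (i : ℕ) < j then i else if (i : ℕ) = j then ⟨m - 1, by have := i.2; omega⟩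
    else ⟨i - 1, by omega⟩
  invFun i := if h : (i : ℕ) < j then i else if h' : (i : ℕ) = m - 1 then ⟨j, by omega⟩
    else ⟨i + 1, by omega⟩
  left_inv i := by
    ext
    by_cases h : (i : ℕ) < j
    · simp [h]
    by_cases h' : (i : ℕ) = j
    · have : ¬ m - 1 < j := by omega
      simp [h', this]
    · have h1 : ¬ (i : ℕ) - 1 < j := by omega
      have h2 : ¬ (i : ℕ) - 1 = m - 1 := by omega
      simp [h, h', h1, h2]
      omega
  right_inv i := by
    ext
    by_cases h : (i : ℕ) < j
    · simp [h]
    by_cases h' : (i : ℕ) = m - 1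
    · have : ¬ m - 1 < j := by omega
      simp [h', this]
    · have h1 : ¬ (i : ℕ) + 1 < j := by omega
      have h2 : ¬ (i : ℕ) + 1 = j := by omega
      simp [h, h', h1, h2]

theorem tailCycle_val (m j : ℕ) (i : Fin m) :
    (tailCycle m j i : ℕ) = if (i : ℕ) < j then (i : ℕ) else if (i : ℕ) = j then m - 1
      else i - 1 := by
  simp only [tailCycle, coe_fn_mk]
  split_ifs <;> rfl

theorem tailCycle_of_lt {m j : ℕ} {i : Fin m} (h : (i : ℕ) < j) : tailCycle m j i = i := by
  ext
  simp [tailCycle_val, h]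

theorem tailCycle_last (m : ℕ) : tailCycle (m + 1) m = 1 := by
  ext i
  rw [tailCycle_val, one_apply]
  split_ifs <;> omega

theorem tailCycle_mul_swap {m : ℕ} {i j : Fin m} (h : (i : ℕ) + 1 = j) :
    tailCycle m j * swap i j = tailCycle m i := by
  ext k
  rw [Perm.mul_apply]
  rcases eq_or_ne k i with rfl | hi
  · rw [swap_apply_left, tailCycle_val, tailCycle_val]
    simp
  rcases eq_or_ne k j with rfl | hj
  · rw [swap_apply_right, tailCycle_val, tailCycle_val]
    split_ifs <;> omega
  · rw [swap_apply_of_ne_of_ne hi hj, tailCycle_val, tailCycle_val]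
    have hi' : (k : ℕ) ≠ i := fun h => hi (Fin.ext h)
    have hj' : (k : ℕ) ≠ j := fun h => hj (Fin.ext h)
    split_ifs <;> omega

theorem tailCycle_commute_swap {m j : ℕ} {a b : Fin m} (ha : (a : ℕ) < j) (hb : (b : ℕ) < j) :
    tailCycle m j * swap a b = swap a b * tailCycle m j := by
  rw [mul_swap_eq_swap_mul, tailCycle_of_lt ha, tailCycle_of_lt hb]

/-- The value at `y` of `G` antisymmetrized on the right over permutations of the first `j`
letters. -/
def antisum {B : Type*} [AddCommGroup B] {m : ℕ} (G : Perm (Fin m) → B) (j : ℕ)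
    (y : Perm (Fin m)) : B :=
  ∑ τ ∈ permsBelow m j, (sign τ : ℤ) • G (y * τ)

section Antisum

variable {B : Type*} [AddCommGroup B] {m : ℕ} {G : Perm (Fin m) → B}

theorem antisum_mul_right {j : ℕ} {ρ : Perm (Fin m)} (hρ : ρ ∈ permsBelow m j)
    (y : Perm (Fin m)) : antisum G j (y * ρ) = (sign ρ : ℤ) • antisum G j y := by
  unfold antisum
  rw [← sum_permsBelow_mul_left hρ fun τ => (sign τ : ℤ) • G (y * τ), Finset.smul_sum]
  refine Finset.sum_congr rfl fun τ _ => ?_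
  have h : (sign ρ : ℤ) * (sign ρ : ℤ) = 1 := by
    rw [← Units.val_mul, Int.units_mul_self, Units.val_one]
  rw [Perm.sign_mul, Units.val_mul, smul_smul, ← mul_assoc, h, one_mul, mul_assoc]

theorem antisum_succ (j : Fin m) (y : Perm (Fin m)) :
    antisum G (j + 1) y =
      antisum G j y - ∑ i ∈ Finset.univ.filter (fun i : Fin m => i < j),
        antisum G j (y * swap i j) := by
  unfold antisum
  rw [sum_permsBelow_succ]
  have hset : (Finset.univ.filter fun i : Fin m => i ≤ j) =
      insert j (Finset.univ.filter fun i : Fin m => i < j) := by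
    ext i
    simp [le_iff_eq_or_lt]
  rw [hset, Finset.sum_insert (by simp), sub_eq_add_neg, ← Finset.sum_neg_distrib]
  congr 1
  · simp only [swap_self, ← Perm.one_def, one_mul]
  · refine Finset.sum_congr rfl fun i hi => ?_
    rw [← Finset.sum_neg_distrib]
    refine Finset.sum_congr rfl fun τ _ => ?_
    have hij : i ≠ j := ne_of_lt (by simpa using hi)
    simp [Perm.sign_mul, sign_swap hij, mul_assoc]

/-- The relation satisfied by the traces `x ↦ tr(x T₁(u) T₂(u - 1) ⋯ T_m(u - m + 1))`. -/
def AdjacentRelation (G : Perm (Fin m) → B) : Prop :=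
  ∀ (i j : Fin m), (i : ℕ) + 1 = j → ∀ x : Perm (Fin m),
    G x - G (x * swap i j) + G (swap i j * x) - G (swap i j * x * swap i j) = 0

theorem antisum_adjacent_mul [IsAddTorsionFree B] (hG : AdjacentRelation G) {i j : Fin m}
    (hij : (i : ℕ) + 1 = j) {k : ℕ} (hk : (j : ℕ) < k) (y : Perm (Fin m)) :
    antisum G k (swap i j * y) = -antisum G k y := by
  have hs : swap i j ∈ permsBelow m k := swap_mem_permsBelow (by omega) hk
  have hne : i ≠ j := by rintro rfl; omega
  have hsum : ∑ τ ∈ permsBelow m k, (sign τ : ℤ) •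
      (G (y * τ) - G (y * τ * swap i j) + G (swap i j * (y * τ))
        - G (swap i j * (y * τ) * swap i j)) = 0 :=
    Finset.sum_eq_zero fun τ _ => by rw [hG i j hij, smul_zero]
  have hright : ∀ z : Perm (Fin m),
      ∑ τ ∈ permsBelow m k, (sign τ : ℤ) • G (z * τ * swap i j) = -antisum G k z := by
    intro z
    rw [antisum, ← sum_permsBelow_mul_right hs, ← Finset.sum_neg_distrib]
    refine Finset.sum_congr rfl fun τ _ => ?_
    simp [Perm.sign_mul, sign_swap hne, mul_assoc]
  simp only [smul_sub, smul_add, Finset.sum_sub_distrib, Finset.sum_add_distrib, ← mul_assoc]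
    at hsum
  rw [hright, hright] at hsum
  change antisum G k y - -antisum G k y + antisum G k (swap i j * y)
    - -antisum G k (swap i j * y) = 0 at hsum
  have h2 : 2 • (antisum G k (swap i j * y) + antisum G k y) = 0 := by
    rw [← hsum]; abel
  exact eq_neg_of_add_eq_zero_left ((smul_eq_zero_iff_right two_ne_zero).1 h2)

theorem antisum_swap_mul [IsAddTorsionFree B] (hG : AdjacentRelation G) {k : ℕ} (d : ℕ) :
    ∀ {i j : Fin m}, (i : ℕ) + d + 1 = j → (j : ℕ) < k → ∀ y : Perm (Fin m),
      antisum G k (swap i j * y) = -antisum G k y := by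
  induction d with
  | zero => exact fun hij hk y => antisum_adjacent_mul hG hij hk y
  | succ d ih =>
    intro i j hij hk y
    let l : Fin m := ⟨j - 1, by omega⟩
    have hl : (l : ℕ) + 1 = j := by simp only [l]; omega
    have hil : i ≠ l := fun h => by rw [← h] at hl; omega
    have hij' : i ≠ j := fun h => by rw [← h] at hij; omega
    rw [swap_comm, ← swap_mul_swap_mul_swap hil hij', mul_assoc, mul_assoc,
      antisum_adjacent_mul hG hl hk, ih (by omega) (by omega), antisum_adjacent_mul hG hl hk,
      neg_neg]

theorem antisum_tailCycle_succ [IsAddTorsionFree B] (hG : AdjacentRelation G) {i j : Fin m}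
    (hij : (i : ℕ) + 1 = j) :
    antisum G (j + 1) (tailCycle m j) =
      antisum G j (tailCycle m j) - (j : ℕ) • antisum G j (tailCycle m i) := by
  rw [antisum_succ]
  congr 1
  have hterm : ∀ l ∈ Finset.univ.filter (fun l : Fin m => l < j),
      antisum G j (tailCycle m j * swap l j) = antisum G j (tailCycle m i) := by
    intro l hl
    have hlj : l < j := by simpa using hl
    rcases eq_or_ne l i with rfl | hli
    · rw [tailCycle_mul_swap hij]
    have hlj' : l ≠ j := ne_of_lt hlj
    have hij' : j ≠ i := by rintro rfl; omega
    have hli' : (l : ℕ) < i := by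
      have : (l : ℕ) ≠ i := fun h => hli (Fin.ext h)
      omega
    have hconj : swap l j = swap l i * swap i j * swap l i := by
      rw [← swap_mul_swap_mul_swap hij' hlj'.symm, swap_comm i l, swap_comm j i]
    have hmem : swap l i ∈ permsBelow m j := swap_mem_permsBelow (by omega) (by omega)
    rw [hconj, mul_assoc, ← mul_assoc, tailCycle_commute_swap (by omega) (by omega), mul_assoc,
      antisum_swap_mul hG ((i : ℕ) - l - 1) (by omega) (by omega), ← mul_assoc,
      antisum_mul_right hmem, sign_swap hli, tailCycle_mul_swap hij]
    simp
  rw [Finset.sum_congr rfl hterm, Finset.sum_const]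
  rw [Finset.filter_gt_eq_Iio, Fin.card_Iio]

end Antisum

/-- The determinant of an `(m + 1) × (m + 1)` matrix with noncommuting entries, multiplied in
increasing row order, with rows taken from `M` except for the last one, which is `r`. -/
def lastRowDet {R : Type*} [Ring R] (M : ℕ → ℕ → R) (r : ℕ → R) (m : ℕ) : R :=
  ∑ σ : Perm (Fin (m + 1)), (sign σ : ℤ) •
    (((List.finRange m).map fun i : Fin m => M i (σ i.castSucc)).prod * r (σ (Fin.last m)))

/-- The row determinant of the leading `m × m` block of `M`. -/
def rowDet {R : Type*} [Ring R] (M : ℕ → ℕ → R) (m : ℕ) : R :=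
  ∑ σ : Perm (Fin m), (sign σ : ℤ) • ((List.finRange m).map fun i : Fin m => M i (σ i)).prod

section RowDet

variable {R : Type*} [Ring R] (M : ℕ → ℕ → R)

theorem rowDet_succ (m : ℕ) : rowDet M (m + 1) = lastRowDet M (M m) m := by
  simp only [rowDet, lastRowDet, List.finRange_succ_last, List.map_append, List.map_map,
    List.prod_append]
  simp [Function.comp_def]

theorem lastRowDet_zero (r : ℕ → R) : lastRowDet M r 0 = r 0 := by
  simp [lastRowDet]

theorem lastRowDet_nsmul (c : ℕ) (r : ℕ → R) (m : ℕ) :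
    lastRowDet M (fun j => (c : R) * r j) m = c • lastRowDet M r m := by
  simp only [lastRowDet, Finset.smul_sum]
  refine Finset.sum_congr rfl fun σ _ => ?_
  rw [smul_comm, nsmul_eq_mul, ← mul_assoc, ← mul_assoc, (Nat.cast_commute c _).eq]

/-- Expansion along the last column of a Hessenberg determinant. -/
theorem lastRowDet_succ (hM : ∀ i j, i + 1 < j → M i j = 0) (r : ℕ → R) (m : ℕ) :
    lastRowDet M r (m + 1) =
      rowDet M (m + 1) * r (m + 1) - lastRowDet M (fun j => M m (m + 1) * r j) m := by
  unfold lastRowDet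
  rw [← permsBelow_self]
  refine (sum_permsBelow_succ_right (Fin.last (m + 1)) _).trans ?_
  have hset : (Finset.univ.filter fun i : Fin (m + 2) => i ≤ Fin.last (m + 1)) = Finset.univ := by
    ext i
    simp [Fin.le_last]
  simp only [Fin.val_last]
  rw [hset, Fin.sum_univ_castSucc, Fin.sum_univ_castSucc]
  have hcast : ∀ (τ : Perm (Fin (m + 1))) (i : Fin (m + 1)),
      extendPerm 1 τ i.castSucc = (τ i).castSucc := extendPerm_castAdd
  have hlast : ∀ τ : Perm (Fin (m + 1)), extendPerm 1 τ (Fin.last (m + 1)) = Fin.last (m + 1) :=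
    fun τ => extendPerm_natAdd τ (0 : Fin 1)
  have hzero : ∑ i : Fin m, ∑ τ ∈ permsBelow (m + 1 + 1) (m + 1),
      (sign (τ * swap i.castSucc.castSucc (Fin.last (m + 1))) : ℤ) •
        (((List.finRange (m + 1)).map fun k : Fin (m + 1) =>
          M k ((τ * swap i.castSucc.castSucc (Fin.last (m + 1))) k.castSucc)).prod *
          r ((τ * swap i.castSucc.castSucc (Fin.last (m + 1))) (Fin.last (m + 1)))) = 0 := by
    refine Finset.sum_eq_zero fun i _ => Finset.sum_eq_zero fun τ hτ => ?_
    rw [List.prod_eq_zero, zero_mul, smul_zero]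
    refine List.mem_map.2 ⟨i.castSucc, List.mem_finRange _, ?_⟩
    rw [Perm.mul_apply, swap_apply_left, mem_permsBelow.1 hτ _ le_rfl]
    exact hM _ _ (by simp)
  rw [hzero, zero_add, add_comm, sub_eq_add_neg]
  congr 1
  · rw [sum_permsBelow_extendPerm (m + 1) 1, rowDet, Finset.sum_mul]
    refine Finset.sum_congr rfl fun τ _ => ?_
    simp [sign_extendPerm, hcast, hlast, mul_assoc]
  · rw [sum_permsBelow_extendPerm (m + 1) 1, ← Finset.sum_neg_distrib]
    refine Finset.sum_congr rfl fun τ _ => ?_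
    have hne : (Fin.last m).castSucc ≠ Fin.last (m + 1) := (Fin.castSucc_lt_last _).ne
    have hfix : ∀ k : Fin m, swap (Fin.last m).castSucc (Fin.last (m + 1)) k.castSucc.castSucc =
        k.castSucc.castSucc := fun k =>
      swap_apply_of_ne_of_ne
        (fun h => (Fin.castSucc_lt_last k).ne (Fin.castSucc_injective _ h))
        (Fin.castSucc_lt_last _).ne
    rw [List.finRange_succ_last]
    simp [sign_extendPerm, Perm.sign_mul, sign_swap hne, hcast, hlast, hfix, Function.comp_def,
      mul_assoc]

end RowDet

/-- The `(g, h)`-entry of `T_1(u) T_2(u - 1) ⋯ T_m(u - m + 1)`. -/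
def legEntry (T : ℂ → Matrix (Fin n) (Fin n) A) (u : ℂ) {m : ℕ} (g h : Fin m → Fin n) : A :=
  ((List.finRange m).map fun s : Fin m => T (u - ((s : ℕ) : ℂ)) (g s) (h s)).prod

/-- The trace of `P_{x⁻¹} T_1(u) T_2(u - 1) ⋯ T_m(u - m + 1)`. -/
def legTrace (T : ℂ → Matrix (Fin n) (Fin n) A) (u : ℂ) {m : ℕ} (x : Perm (Fin m)) : A :=
  ∑ f : Fin m → Fin n, legEntry T u (f ∘ x) f

theorem prod_Tleg_apply {R : Type*} [Ring R] (T : ℂ → Matrix (Fin n) (Fin n) R) {m : ℕ}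
    (v : Fin m → ℂ) (L : List (Fin m)) (hL : L.Nodup) (g h : Fin m → Fin n) :
    (L.map fun s => Tleg T s (v s)).prod g h =
      if ∀ t, t ∉ L → g t = h t then (L.map fun s => T (v s) (g s) (h s)).prod else 0 := by
  induction L generalizing g with
  | nil => simp [Matrix.one_apply, funext_iff]
  | cons s L ih =>
    rw [List.nodup_cons] at hL
    rw [List.map_cons, List.prod_cons, Matrix.mul_apply,
      Finset.sum_eq_single (Function.update g s (h s))]
    · rw [ih hL.2]
      have hleft : Tleg T s (v s) g (Function.update g s (h s)) = T (v s) (g s) (h s) := by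
        unfold Tleg
        rw [if_pos fun t ht => by rw [Function.update_of_ne ht], Function.update_self]
      have hmap : (L.map fun t => T (v t) (Function.update g s (h s) t) (h t)) =
          L.map fun t => T (v t) (g t) (h t) :=
        List.map_congr_left fun t ht => by
          rw [Function.update_of_ne (by rintro rfl; exact hL.1 ht)]
      have hiff : (∀ t, t ∉ L → Function.update g s (h s) t = h t) ↔
          ∀ t, t ∉ s :: L → g t = h t := by
        refine forall_congr' fun t => ?_
        rcases eq_or_ne t s with rfl | hts
        · simp
        · simp [hts]
      rw [hleft, hmap, List.map_cons, List.prod_cons, mul_ite, mul_zero]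
      exact if_congr hiff rfl rfl
    · intro f _ hf
      rw [ih hL.2]
      by_cases h1 : ∀ t, t ≠ s → g t = f t
      · rw [if_neg, mul_zero]
        intro h2
        refine hf (funext fun t => ?_)
        rcases eq_or_ne t s with rfl | hts
        · rw [Function.update_self, h2 t hL.1]
        · rw [Function.update_of_ne hts, h1 t hts]
      · rw [Tleg, if_neg h1, zero_mul]
    · simp

theorem TT_apply {R : Type*} [Ring R] (T : ℂ → Matrix (Fin n) (Fin n) R) (m : ℕ) (u : ℂ)
    (g h : Fin m → Fin n) :
    TT T m u (-1) g h = legEntry T u g h := by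
  rw [TT, prod_Tleg_apply T _ _ (List.nodup_finRange m), if_pos (by simp), legEntry]
  simp [sub_eq_add_neg]

theorem trace_Pleg_mul_TT (T : ℂ → Matrix (Fin n) (Fin n) A) (m : ℕ) (u : ℂ)
    (σ : Perm (Fin m)) : Matrix.trace (Pleg n A σ * TT T m u (-1)) = legTrace T u σ⁻¹ := by
  rw [Matrix.trace, legTrace]
  refine Finset.sum_congr rfl fun f _ => ?_
  rw [Matrix.diag_apply, Matrix.mul_apply, Finset.sum_eq_single (f ∘ ⇑σ⁻¹)]
  · rw [Pleg, if_pos, map_one, one_mul, TT_apply]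
    ext i
    simp
  · intro g _ hg
    rw [Pleg, if_neg, zero_mul]
    rintro rfl
    refine hg ?_
    ext i
    simp
  · simp

theorem factorial_smul_esym (T : ℂ → Matrix (Fin n) (Fin n) A) (m : ℕ) (u : ℂ) :
    (m.factorial : ℂ) • esym T m u = antisum (legTrace T u) m (1 : Perm (Fin m)) := by
  have hm : (m.factorial : ℂ) ≠ 0 := by exact_mod_cast m.factorial_ne_zero
  rw [esym, Aleg, smul_mul_assoc, Matrix.trace_smul, smul_smul, mul_inv_cancel₀ hm, one_smul,
    Finset.sum_mul, Matrix.trace_sum, antisum, permsBelow_self,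
    ← Equiv.sum_comp (Equiv.inv (Perm (Fin m)))]
  refine Finset.sum_congr rfl fun σ _ => ?_
  rw [smul_mul_assoc, Matrix.trace_smul, trace_Pleg_mul_TT, Int.cast_smul_eq_zsmul]
  simp

theorem RTT.entry_relation {T : ℂ → Matrix (Fin n) (Fin n) A} (hT : RTT T) (v : ℂ)
    (a b c d : Fin n) :
    T v a c * T (v - 1) b d - T v b c * T (v - 1) a d
      + T v a d * T (v - 1) b c - T v b d * T (v - 1) a c = 0 := by
  have hswap : legSwap 2 1 2 = swap 0 1 := by decide
  have h01 : ∀ g h : Fin 2 → Fin n, (Tleg T (0 : Fin 2) v * Tleg T (1 : Fin 2) (v - 1)) g h =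
      T v (g 0) (h 0) * T (v - 1) (g 1) (h 1) := by
    intro g h
    have := prod_Tleg_apply T ![v, v - 1] [0, 1] (by decide) g h
    simpa [Fin.forall_fin_two] using this
  have hleft : ∀ (X : LegMatrix n 2 A) (g h : Fin 2 → Fin n),
      (Pleg n A (swap (0 : Fin 2) 1) * X : LegMatrix n 2 A) g h = X (g ∘ swap 0 1) h := by
    intro X g h
    rw [Matrix.mul_apply, Finset.sum_eq_single (g ∘ swap 0 1)]
    · rw [Pleg, if_pos (by ext i; simp), map_one, one_mul]
    · intro f _ hf
      rw [Pleg, if_neg, zero_mul]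
      rintro rfl
      exact hf (by ext i; simp)
    · simp
  have hright : ∀ (X : LegMatrix n 2 A) (g h : Fin 2 → Fin n),
      (X * Pleg n A (swap (0 : Fin 2) 1) : LegMatrix n 2 A) g h = X g (h ∘ swap 0 1) := by
    intro X g h
    rw [Matrix.mul_apply, Finset.sum_eq_single (h ∘ swap 0 1)]
    · rw [Pleg, if_pos rfl, map_one, mul_one]
    · intro f _ hf
      rw [Pleg, if_neg hf, mul_zero]
    · simp
  have hR := hT v (v - 1)
  rw [hswap, sub_sub_cancel, one_smul, sub_mul, one_mul, mul_sub, mul_one, sub_mul, mul_assoc] at hR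
  have e1 := congrFun (congrFun hR ![a, b]) ![c, d]
  have e2 := congrFun (congrFun hR ![a, b]) ![d, c]
  have hsc : (![c, d] : Fin 2 → Fin n) ∘ swap 0 1 = ![d, c] := by
    ext i; fin_cases i <;> simp
  have hsd : (![d, c] : Fin 2 → Fin n) ∘ swap 0 1 = ![c, d] := by
    ext i; fin_cases i <;> simp
  rw [Matrix.sub_apply, Matrix.sub_apply, h01, hleft, h01, hright, hsc] at e1
  rw [Matrix.sub_apply, Matrix.sub_apply, h01, hleft, h01, hright, hsd] at e2
  have hsum := congrArg₂ (· + ·) e1 e2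
  simp at hsum
  rw [← sub_eq_zero] at hsum
  rw [← hsum]
  abel

theorem finRange_split {m : ℕ} {i j : Fin m} (hij : (i : ℕ) + 1 = j) :
    List.finRange m =
      (List.finRange m).take i ++ i :: j :: (List.finRange m).drop (j + 1) := by
  conv_lhs => rw [← List.take_append_drop i (List.finRange m)]
  rw [List.drop_eq_getElem_cons (by simp), List.drop_eq_getElem_cons (by simp; omega)]
  simp [hij]

theorem legEntry_adjacent {T : ℂ → Matrix (Fin n) (Fin n) A} (hT : RTT T) (u : ℂ) {m : ℕ}
    {i j : Fin m} (hij : (i : ℕ) + 1 = j) (g h : Fin m → Fin n) :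
    legEntry T u g h - legEntry T u (g ∘ swap i j) h + legEntry T u g (h ∘ swap i j)
      - legEntry T u (g ∘ swap i j) (h ∘ swap i j) = 0 := by
  have htake : ∀ k ∈ (List.finRange m).take i, swap i j k = k := by
    intro k hk
    obtain ⟨l, hl, rfl⟩ := List.mem_take_iff_getElem.1 hk
    simp only [List.length_finRange] at hl
    refine swap_apply_of_ne_of_ne (fun h => ?_) (fun h => ?_) <;>
    · have := congrArg Fin.val h
      simp at this
      omega
  have hdrop : ∀ k ∈ (List.finRange m).drop (j + 1), swap i j k = k := by
    intro k hk
    obtain ⟨l, hl, rfl⟩ := List.mem_drop_iff_getElem.1 hk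
    refine swap_apply_of_ne_of_ne (fun h => ?_) (fun h => ?_) <;>
    · have := congrArg Fin.val h
      simp at this
      omega
  have hv : u - ((j : ℕ) : ℂ) = u - ((i : ℕ) : ℂ) - 1 := by
    rw [← hij]; push_cast; ring
  let X := ((List.finRange m).take i).map fun s : Fin m => T (u - ((s : ℕ) : ℂ)) (g s) (h s)
  let Z := ((List.finRange m).drop (j + 1)).map
    fun s : Fin m => T (u - ((s : ℕ) : ℂ)) (g s) (h s)
  have hsplit : ∀ g' h' : Fin m → Fin n,
      (∀ k, swap i j k = k → g' k = g k) → (∀ k, swap i j k = k → h' k = h k) →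
      legEntry T u g' h' = X.prod *
        (T (u - ((i : ℕ) : ℂ)) (g' i) (h' i) * T (u - ((i : ℕ) : ℂ) - 1) (g' j) (h' j)) *
          Z.prod := by
    intro g' h' hg hh
    have hX : (((List.finRange m).take i).map fun s : Fin m =>
        T (u - ((s : ℕ) : ℂ)) (g' s) (h' s)) = X :=
      List.map_congr_left fun k hk => by rw [hg k (htake k hk), hh k (htake k hk)]
    have hZ : (((List.finRange m).drop (j + 1)).map fun s : Fin m =>
        T (u - ((s : ℕ) : ℂ)) (g' s) (h' s)) = Z :=
      List.map_congr_left fun k hk => by rw [hg k (hdrop k hk), hh k (hdrop k hk)]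
    rw [legEntry, finRange_split hij, List.map_append, List.prod_append, List.map_cons,
      List.map_cons, List.prod_cons, List.prod_cons, hX, hZ, hv]
    simp only [mul_assoc]
  have hcomp : ∀ (f : Fin m → Fin n) (k : Fin m), swap i j k = k → (f ∘ swap i j) k = f k :=
    fun f k hk => congrArg f hk
  rw [hsplit g h (fun _ _ => rfl) (fun _ _ => rfl), hsplit _ h (hcomp g) (fun _ _ => rfl),
    hsplit g _ (fun _ _ => rfl) (hcomp h), hsplit _ _ (hcomp g) (hcomp h)]
  simp only [Function.comp_apply, swap_apply_left, swap_apply_right]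
  rw [← sub_mul, ← mul_sub, ← add_mul, ← mul_add, ← sub_mul, ← mul_sub,
    hT.entry_relation, mul_zero, zero_mul]

theorem legTrace_adjacentRelation {T : ℂ → Matrix (Fin n) (Fin n) A} (hT : RTT T) (u : ℂ)
    (m : ℕ) : AdjacentRelation (legTrace T u : Perm (Fin m) → A) := by
  intro i j hij x
  have hleft : ∀ y : Perm (Fin m),
      legTrace T u (swap i j * y) =
        ∑ f : Fin m → Fin n, legEntry T u (f ∘ y) (f ∘ swap i j) := by
    intro y
    rw [legTrace, ← Equiv.sum_comp ((swap i j).arrowCongr (Equiv.refl (Fin n)))]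
    refine Finset.sum_congr rfl fun f _ => ?_
    congr 1
    ext k
    simp
  rw [mul_assoc, hleft, hleft, legTrace, legTrace, ← Finset.sum_sub_distrib,
    ← Finset.sum_add_distrib, ← Finset.sum_sub_distrib]
  exact Finset.sum_eq_zero fun f _ => legEntry_adjacent hT u hij (f ∘ x) f

theorem prod_matrix_apply {R : Type*} [Ring R] (b : ℕ) (M : Fin b → Matrix (Fin n) (Fin n) R)
    (x y : Fin n) :
    ((List.finRange b).map M).prod x y =
      ∑ f : Fin b → Fin n, if (Fin.cons x f : Fin (b + 1) → Fin n) (Fin.last b) = y then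
        ((List.finRange b).map fun s : Fin b =>
          M s ((Fin.cons x f : Fin (b + 1) → Fin n) s.castSucc) (f s)).prod else 0 := by
  induction b generalizing x with
  | zero => simp [Matrix.one_apply, Fin.last]
  | succ b ih =>
    rw [List.finRange_succ, List.map_cons, List.prod_cons, List.map_map, Matrix.mul_apply,
      ← (Fin.consEquiv fun _ => Fin n).sum_comp, Fintype.sum_prod_type]
    refine Finset.sum_congr rfl fun z _ => ?_
    rw [Function.comp_def, ih, Finset.mul_sum]
    refine Finset.sum_congr rfl fun f _ => ?_
    rw [mul_ite, mul_zero]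
    simp [Fin.consEquiv, Function.comp_def, ← Fin.succ_last]

theorem pminus_eq_trace {R : Type*} [Ring R] (T : ℂ → Matrix (Fin n) (Fin n) R) (b : ℕ) (v : ℂ) :
    pminus T b v =
      Matrix.trace ((List.finRange b).map fun i : Fin b => T (v - ((i : ℕ) : ℂ))).prod := by
  unfold pminus
  congr 2
  simp [← List.map_eq_flatMap, -List.map_coe_finRange_eq_range, Function.comp_def]

theorem pminus_eq_legTrace {R : Type*} [Ring R] (T : ℂ → Matrix (Fin n) (Fin n) R) (b : ℕ)
    (v : ℂ) :
    pminus T (b + 1) v = legTrace T v (tailCycle (b + 1) 0) := by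
  rw [pminus_eq_trace, Matrix.trace]
  simp only [Matrix.diag_apply, prod_matrix_apply]
  rw [Finset.sum_comm, legTrace]
  refine Finset.sum_congr rfl fun f _ => ?_
  rw [Finset.sum_eq_single (f (Fin.last b))]
  · rw [if_pos (by rw [← Fin.succ_last, Fin.cons_succ]), legEntry]
    congr 1
    refine List.map_congr_left fun s _ => ?_
    congr 1
    refine Fin.cases ?_ (fun k => ?_) s
    · rw [Fin.castSucc_zero, Fin.cons_zero, Function.comp_apply]
      congr 1
    · rw [Fin.castSucc_succ, Fin.cons_succ, Function.comp_apply]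
      congr 1
  · intro x _ hx
    rw [if_neg]
    rw [← Fin.succ_last, Fin.cons_succ]
    exact hx.symm
  · simp

theorem legTrace_tailCycle_mul {R : Type*} [Ring R] (T : ℂ → Matrix (Fin n) (Fin n) R) (a b : ℕ)
    (u : ℂ) (τ : Perm (Fin a)) :
    legTrace T u (tailCycle (a + b) a * extendPerm b τ) =
      legTrace T u τ * legTrace T (u - (a : ℂ)) (tailCycle b 0) := by
  simp only [legTrace]
  rw [← (Fin.appendEquiv a b).sum_comp, Fintype.sum_prod_type, Finset.sum_mul_sum]
  refine Finset.sum_congr rfl fun f _ => Finset.sum_congr rfl fun g _ => ?_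
  have hlow : ∀ i : Fin a, tailCycle (a + b) a (extendPerm b τ (Fin.castAdd b i)) =
      Fin.castAdd b (τ i) := fun i => by
    rw [extendPerm_castAdd, tailCycle_of_lt (by simp)]
  have hhigh : ∀ i : Fin b, tailCycle (a + b) a (extendPerm b τ (Fin.natAdd a i)) =
      Fin.natAdd a (tailCycle b 0 i) := fun i => by
    rw [extendPerm_natAdd]
    ext
    simp only [tailCycle_val, Fin.val_natAdd]
    split_ifs <;> omega
  simp only [legEntry, ← List.ofFn_eq_map]
  rw [List.ofFn_add, List.prod_append]
  change (List.ofFn fun i : Fin a => T (u - ((Fin.castAdd b i : ℕ) : ℂ))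
    (Fin.append f g (tailCycle (a + b) a (extendPerm b τ (Fin.castAdd b i))))
    (Fin.append f g (Fin.castAdd b i))).prod * (List.ofFn fun i : Fin b =>
    T (u - ((Fin.natAdd a i : ℕ) : ℂ))
    (Fin.append f g (tailCycle (a + b) a (extendPerm b τ (Fin.natAdd a i))))
    (Fin.append f g (Fin.natAdd a i))).prod = _
  simp only [hlow, hhigh, Fin.append_left, Fin.append_right, Fin.val_castAdd, Fin.val_natAdd,
    Nat.cast_add, sub_sub, Function.comp_apply]

theorem antisum_tailCycle {R : Type*} [Ring R] (T : ℂ → Matrix (Fin n) (Fin n) R) (a b : ℕ)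
    (u : ℂ) :
    antisum (legTrace T u) a (tailCycle (a + (b + 1)) a) =
      antisum (legTrace T u) a (1 : Perm (Fin a)) * pminus T (b + 1) (u - (a : ℂ)) := by
  rw [antisum, sum_permsBelow_extendPerm, antisum, permsBelow_self, Finset.sum_mul]
  refine Finset.sum_congr rfl fun τ _ => ?_
  rw [sign_extendPerm, legTrace_tailCycle_mul, pminus_eq_legTrace, one_mul, smul_mul_assoc]

/-- The Hessenberg matrix of power sums, with rows and columns indexed from `0`. -/
noncomputable def powerSumMatrix (T : ℂ → Matrix (Fin n) (Fin n) A) (u : ℂ) (i j : ℕ) : A :=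
  if j ≤ i then pminus T (i - j + 1) (u - (j : ℂ))
  else if j = i + 1 then ((i + 1 : ℕ) : A)
  else 0

theorem antisum_eq_rowDet {T : ℂ → Matrix (Fin n) (Fin n) A} (hT : RTT T) (u : ℂ) (m : ℕ) :
    antisum (legTrace T u) m (1 : Perm (Fin m)) = rowDet (powerSumMatrix T u) m := by
  have : IsAddTorsionFree A := by
    have : Module ℚ A := Module.compHom A (algebraMap ℚ ℂ)
    exact IsAddTorsionFree.of_module_rat A
  induction m using Nat.strong_induction_on with
  | _ m ih =>
  rcases m with _ | m
  · rw [antisum, permsBelow_self, rowDet]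
    simp [legTrace, legEntry]
  have hHess : ∀ i j, i + 1 < j → powerSumMatrix T u i j = 0 := by
    intro i j hij
    rw [powerSumMatrix, if_neg (by omega), if_neg (by omega)]
  have hbase : ∀ j ≤ m, antisum (legTrace T u) j (tailCycle (m + 1) j) =
      rowDet (powerSumMatrix T u) j * powerSumMatrix T u m j := by
    intro j hj
    obtain ⟨b, rfl⟩ := Nat.exists_eq_add_of_le hj
    rw [← ih j (by omega), powerSumMatrix, if_pos hj, Nat.add_sub_cancel_left]
    exact antisum_tailCycle T j b u
  have hstep : ∀ j ≤ m, antisum (legTrace T u) (j + 1) (tailCycle (m + 1) j) =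
      lastRowDet (powerSumMatrix T u) (powerSumMatrix T u m) j := by
    intro j
    induction j with
    | zero =>
      intro hj
      have h0 := hbase 0 hj
      rw [show rowDet (powerSumMatrix T u) 0 = 1 by simp [rowDet], one_mul] at h0
      rw [lastRowDet_zero, ← h0]
      have hs := antisum_succ (G := legTrace T u) (0 : Fin (m + 1)) (tailCycle (m + 1) 0)
      simpa using hs
    | succ j ihj =>
      intro hj
      have hrec := antisum_tailCycle_succ (legTrace_adjacentRelation hT u (m + 1))
        (i := ⟨j, by omega⟩) (j := ⟨j + 1, by omega⟩) rfl
      simp only at hrec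
      have hc : powerSumMatrix T u j (j + 1) = ((j + 1 : ℕ) : A) := by
        rw [powerSumMatrix, if_neg (by omega), if_pos rfl]
      rw [hrec, hbase _ hj, ihj (by omega), lastRowDet_succ _ hHess, hc, lastRowDet_nsmul]
  rw [rowDet_succ, ← hstep m le_rfl, tailCycle_last]

end

/-- `m! • e_m(u)` equals the row-determinant of the `m×m` matrix `M` with
(1-based) entries `M_{i,j} = p⁻_{i−j+1}(u−j+1)` for `j ≤ i`, `M_{i,i+1} = i • 1`,
and `M_{i,j} = 0` for `j > i+1`.  (Below `i`, `j` are 0-based.) -/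
theorem factorial_esym_eq_rowdet (hn : 1 ≤ n) (T : ℂ → Matrix (Fin n) (Fin n) A)
    (hT : RTT T) (m : ℕ) (hm : 1 ≤ m) (u : ℂ) :
    (m.factorial : ℂ) • esym T m u =
      ∑ σ : Equiv.Perm (Fin m), ((Equiv.Perm.sign σ : ℤ) : ℂ) •
        ((List.finRange m).map (fun i : Fin m =>
          if ((σ i : ℕ)) ≤ (i : ℕ) then
            pminus T ((i : ℕ) - (σ i : ℕ) + 1) (u - ((σ i : ℕ) : ℂ))
          else if ((σ i : ℕ)) = (i : ℕ) + 1 then (((i : ℕ) + 1 : ℕ) : A)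
          else 0)).prod := by
  rw [factorial_smul_esym, antisum_eq_rowDet hT, rowDet]
  refine Finset.sum_congr rfl fun σ _ => ?_
  rw [Int.cast_smul_eq_zsmul]
  rfl
end
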